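/- arXiv:2504.10722 — 2 statements merged into one kernel-verified Lean document; each statement's English description precedes it below -/
import Mathlib

section
/- Let D be an integral domain that is not a field, with fraction field F, and let K be a field containing D (via an injective ring homomorphism ι : D → K) such that there exists α ∈ K not lying in the fraction field of D inside K (i.e., there is no pair a, b ∈ D with b ≠ 0 and α·ι(b) = ι(a)). Then the subring R = D + xK[x] of K[x], consisting of all polynomials over K whose constant coefficient lies in ι(D), is not a pre-Schreier domain. -/
/-- A nonzero element `p` is primal if whenever `p ∣ r * s` we can write `p = p₁ * p₂`
with `p₁ ∣ r` and `p₂ ∣ s`. -/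
def IsPrimalElem {R : Type*} [CommRing R] (p : R) : Prop :=
  ∀ r s : R, p ∣ r * s → ∃ p₁ p₂ : R, p = p₁ * p₂ ∧ p₁ ∣ r ∧ p₂ ∣ s

/-- `R` is pre-Schreier if every nonzero nonunit of `R` is primal. -/
def IsPreSchreier (R : Type*) [CommRing R] : Prop :=
  ∀ p : R, p ≠ 0 → ¬ IsUnit p → IsPrimalElem p

/-- The subring `D + x K[x]` of `K[x]`: polynomials over `K` whose constant
coefficient lies in the image of `D` under `ι`. -/
noncomputable def DplusXKX {D K : Type*} [CommRing D] [Field K] (ι : D →+* K) :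
    Subring (Polynomial K) :=
  Subring.comap (Polynomial.constantCoeff (R := K)) ι.range

open Polynomial in
theorem mem_DplusXKX {D K : Type*} [CommRing D] [Field K] {ι : D →+* K} {f : K[X]} :
    f ∈ DplusXKX ι ↔ ∃ d : D, ι d = f.coeff 0 := by
  simp [DplusXKX, Subring.mem_comap, RingHom.mem_range]

open Polynomial in
theorem C_mul_X_mem_DplusXKX {D K : Type*} [CommRing D] [Field K] (ι : D →+* K) (c : K) :
    C c * X ∈ DplusXKX ι :=
  mem_DplusXKX.2 ⟨0, by simp⟩

theorem stmt7 {D K : Type*} [CommRing D] [IsDomain D] (hD : ¬ IsField D)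
    [Field K] (ι : D →+* K) (hι : Function.Injective ι)
    (α : K) (hα : ¬ ∃ a b : D, b ≠ 0 ∧ α * ι b = ι a) :
    ¬ IsPreSchreier ↥(DplusXKX ι) := by
  have hα0 : α ≠ 0 := by
    rintro rfl
    exact hα ⟨0, 1, one_ne_zero, by simp⟩
  let x : DplusXKX ι := ⟨_, C_mul_X_mem_DplusXKX ι 1⟩
  let r : DplusXKX ι := ⟨_, C_mul_X_mem_DplusXKX ι α⟩
  let s : DplusXKX ι := ⟨_, C_mul_X_mem_DplusXKX ι α⁻¹⟩
  intro h
  have hx0 : x ≠ 0 := by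
    intro h0
    have := congrArg (fun f : DplusXKX ι => (f : Polynomial K).coeff 1) h0
    simp [x] at this
  have hxu : ¬ IsUnit x := by
    intro hu
    obtain ⟨v, hv⟩ := hu.exists_right_inv
    have := congrArg (fun f : DplusXKX ι => (f : Polynomial K).coeff 0) hv
    simp [x, Polynomial.mul_coeff_zero] at this
  have hdvd : x ∣ r * s := by
    refine ⟨x, Subtype.ext ?_⟩
    have hC : (Polynomial.C α * Polynomial.C α⁻¹ : Polynomial K) = 1 := by
      rw [← Polynomial.C_mul, mul_inv_cancel₀ hα0, Polynomial.C_1]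
    simp only [x, r, s, Subring.coe_mul, Polynomial.C_1]
    linear_combination Polynomial.X ^ 2 * hC
  obtain ⟨p, q, hpq, ⟨a, ha⟩, ⟨b, hb⟩⟩ := h x hx0 hxu r s hdvd
  obtain ⟨p₀, hp₀⟩ := mem_DplusXKX.1 p.2
  obtain ⟨q₀, hq₀⟩ := mem_DplusXKX.1 q.2
  obtain ⟨a₀, ha₀⟩ := mem_DplusXKX.1 a.2
  obtain ⟨b₀, hb₀⟩ := mem_DplusXKX.1 b.2
  have hpq0 := congrArg (fun f : DplusXKX ι => (f : Polynomial K).coeff 0) hpq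
  have hpq1 := congrArg (fun f : DplusXKX ι => (f : Polynomial K).coeff 1) hpq
  have ha1 := congrArg (fun f : DplusXKX ι => (f : Polynomial K).coeff 1) ha
  have hb1 := congrArg (fun f : DplusXKX ι => (f : Polynomial K).coeff 1) hb
  simp only [x, r, s, Subring.coe_mul, Polynomial.mul_coeff_zero, Polynomial.mul_coeff_one,
    Polynomial.coeff_C_zero, Polynomial.coeff_X_zero, Polynomial.coeff_X_one,
    Polynomial.coeff_C_succ, mul_zero, mul_one, add_zero,
    ← hp₀, ← hq₀, ← ha₀, ← hb₀] at hpq0 hpq1 ha1 hb1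
  rcases mul_eq_zero.1 hpq0.symm with h0 | h0
  · rw [h0, zero_mul, zero_add] at hpq1 ha1
    refine hα ⟨a₀, q₀, ?_, ?_⟩
    · rintro rfl
      simp at hpq1
    · linear_combination ι q₀ * ha1 - ι a₀ * hpq1
  · rw [h0, mul_zero, add_zero] at hpq1
    rw [h0, zero_mul, zero_add] at hb1
    refine hα ⟨p₀, b₀, ?_, ?_⟩
    · rintro rfl
      simp [hα0] at hb1
    · have hinv := mul_inv_cancel₀ hα0
      linear_combination (-α * ι b₀) * (-hpq1) - α * ι p₀ * hb1 + ι p₀ * hinv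
end

section
/- The subring R = ℤ + xℝ[x] of ℝ[x], consisting of all real polynomials whose constant coefficient is an integer, is a GL-domain. -/
/-- A polynomial over `R` is primitive if every element of `R` dividing all of its
coefficients is a unit. -/
def IsPrimitivePoly {R : Type*} [CommRing R] (f : Polynomial R) : Prop :=
  ∀ d : R, (∀ n : ℕ, d ∣ f.coeff n) → IsUnit d

/-- `R` is a GL-domain if the product of any two primitive polynomials over `R` is
again primitive. -/
def IsGLDomain (R : Type*) [CommRing R] : Prop :=
  ∀ f g : Polynomial R, IsPrimitivePoly f → IsPrimitivePoly g → IsPrimitivePoly (f * g)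

/-- The subring `ℤ + x ℝ[x]` of `ℝ[x]`: real polynomials whose constant coefficient
is an integer. -/
noncomputable def ZplusXRX : Subring (Polynomial ℝ) :=
  Subring.comap (Polynomial.constantCoeff (R := ℝ)) (Int.castRingHom ℝ).range

open Polynomial

namespace ZplusXRX

theorem mem_iff {a : ℝ[X]} : a ∈ ZplusXRX ↔ ∃ k : ℤ, (k : ℝ) = a.coeff 0 := by
  simp [ZplusXRX, Subring.mem_comap, RingHom.mem_range]

theorem exists_int_eq_coeff_zero (a : ZplusXRX) : ∃ k : ℤ, (k : ℝ) = (a : ℝ[X]).coeff 0 :=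
  mem_iff.1 a.2

theorem coeff_zero_intCast (n : ℤ) : (((n : ZplusXRX) : ℝ[X])).coeff 0 = n := by
  simp [coeff_zero_eq_eval_zero]

theorem intCast_dvd_iff {n : ℤ} (hn : n ≠ 0) {a : ZplusXRX} {k : ℤ}
    (hk : (k : ℝ) = (a : ℝ[X]).coeff 0) : (n : ZplusXRX) ∣ a ↔ n ∣ k := by
  have hn' : (n : ℝ) ≠ 0 := Int.cast_ne_zero.2 hn
  constructor
  · rintro ⟨b, rfl⟩
    obtain ⟨m, hm⟩ := exists_int_eq_coeff_zero b
    refine ⟨m, ?_⟩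
    rw [Subring.coe_mul, mul_coeff_zero, coeff_zero_intCast, ← hm] at hk
    exact_mod_cast hk
  · rintro ⟨m, rfl⟩
    refine ⟨⟨C (n : ℝ)⁻¹ * a, mem_iff.2 ⟨m, ?_⟩⟩, Subtype.ext ?_⟩
    · rw [coeff_C_mul, ← hk]
      push_cast
      field_simp
    · have hC : ((n : ZplusXRX) : ℝ[X]) = C (n : ℝ) := by simp
      rw [Subring.coe_mul, hC, ← mul_assoc, ← C_mul, mul_inv_cancel₀ hn', C_1, one_mul]

theorem prime_intCast {p : ℤ} (hp : Prime p) : Prime (p : ZplusXRX) := by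
  refine ⟨fun h ↦ hp.ne_zero ?_, fun h ↦ hp.not_isUnit ?_, fun a b h ↦ ?_⟩
  · have := coeff_zero_intCast p
    rw [h] at this
    simpa using this.symm
  · exact isUnit_iff_dvd_one.2 ((intCast_dvd_iff hp.ne_zero (by simp)).1 (isUnit_iff_dvd_one.1 h))
  · obtain ⟨k, hk⟩ := exists_int_eq_coeff_zero a
    obtain ⟨m, hm⟩ := exists_int_eq_coeff_zero b
    rw [intCast_dvd_iff hp.ne_zero (k := k * m) (by simp [hk, hm, mul_coeff_zero])] at h
    rw [intCast_dvd_iff hp.ne_zero hk, intCast_dvd_iff hp.ne_zero hm]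
    exact hp.dvd_or_dvd h

theorem dvd_of_coe_dvd {q a : ZplusXRX} (hq : (q : ℝ[X]).coeff 0 = 1)
    (h : (q : ℝ[X]) ∣ a) : q ∣ a := by
  obtain ⟨c, hc⟩ := h
  obtain ⟨k, hk⟩ := exists_int_eq_coeff_zero a
  refine ⟨⟨c, mem_iff.2 ⟨k, ?_⟩⟩, Subtype.ext hc⟩
  rw [hk, hc, mul_coeff_zero, hq, one_mul]

theorem prime_of_prime_coe {q : ZplusXRX} (hq : (q : ℝ[X]).coeff 0 = 1)
    (h : Prime (q : ℝ[X])) : Prime q := by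
  refine ⟨fun h0 ↦ h.ne_zero (by simp [h0]), fun hu ↦ h.not_isUnit (hu.map ZplusXRX.subtype),
    fun a b hab ↦ ?_⟩
  exact (h.dvd_or_dvd (map_dvd ZplusXRX.subtype hab)).imp (dvd_of_coe_dvd hq) (dvd_of_coe_dvd hq)

theorem isUnit_of_isUnit_coe {d : ZplusXRX} {k : ℤ} (hk : (k : ℝ) = (d : ℝ[X]).coeff 0)
    (hku : IsUnit k) (hd : IsUnit (d : ℝ[X])) : IsUnit d := by
  obtain ⟨r, -, hr⟩ := Polynomial.isUnit_iff.1 hd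
  have hdk : d = (k : ZplusXRX) := by
    refine Subtype.ext ?_
    rw [← hr, coeff_C_zero] at hk
    rw [← hr, ← hk]
    simp
  rw [hdk]
  exact hku.map (Int.castRingHom ZplusXRX)

theorem exists_prime_dvd {d : ZplusXRX} (hd : ¬IsUnit d) : ∃ p : ZplusXRX, Prime p ∧ p ∣ d := by
  obtain ⟨k, hk⟩ := exists_int_eq_coeff_zero d
  by_cases hku : IsUnit k
  · have hdu : ¬IsUnit (d : ℝ[X]) := fun h ↦ hd (isUnit_of_isUnit_coe hk hku h)
    have hd0 : (d : ℝ[X]).coeff 0 ≠ 0 := by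
      rw [← hk]
      exact Int.cast_ne_zero.2 hku.ne_zero
    obtain ⟨q, hq, hqd⟩ := WfDvdMonoid.exists_irreducible_factor hdu
      (fun h ↦ hd0 (by simp [h]))
    have hq0 : q.coeff 0 ≠ 0 := by
      obtain ⟨c, hc⟩ := hqd
      rw [hc, mul_coeff_zero] at hd0
      exact left_ne_zero_of_mul hd0
    have hassoc : Associated q (C (q.coeff 0)⁻¹ * q) :=
      (associated_unit_mul_left q _ (isUnit_C.2 (inv_ne_zero hq0).isUnit)).symm
    have hone : (C (q.coeff 0)⁻¹ * q).coeff 0 = 1 := by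
      rw [coeff_C_mul, inv_mul_cancel₀ hq0]
    refine ⟨⟨C (q.coeff 0)⁻¹ * q, mem_iff.2 ⟨1, by rw [hone, Int.cast_one]⟩⟩,
      prime_of_prime_coe hone (hassoc.prime hq.prime),
      dvd_of_coe_dvd hone (hassoc.dvd_iff_dvd_left.1 hqd)⟩
  · obtain ⟨p, hp, hpk⟩ : ∃ p : ℤ, Prime p ∧ p ∣ k := by
      by_cases hk0 : k = 0
      · exact ⟨2, Int.prime_two, hk0 ▸ dvd_zero 2⟩
      · obtain ⟨p, hp, hpk⟩ := WfDvdMonoid.exists_irreducible_factor hku hk0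
        exact ⟨p, hp.prime, hpk⟩
    exact ⟨p, prime_intCast hp, (intCast_dvd_iff hp.ne_zero hk).2 hpk⟩

end ZplusXRX

theorem isGLDomain_of_exists_prime_dvd {R : Type*} [CommRing R]
    (h : ∀ d : R, ¬IsUnit d → ∃ p : R, Prime p ∧ p ∣ d) : IsGLDomain R := by
  intro f g hf hg d hd
  by_contra hdu
  obtain ⟨p, hp, hpd⟩ := h d hdu
  have hpfg : C p ∣ f * g := C_dvd_iff_dvd_coeff _ _ |>.2 fun n ↦ hpd.trans (hd n)
  rcases (prime_C_iff.2 hp).dvd_or_dvd hpfg with hdvd | hdvd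
  · exact hp.not_isUnit (hf p ((C_dvd_iff_dvd_coeff _ _).1 hdvd))
  · exact hp.not_isUnit (hg p ((C_dvd_iff_dvd_coeff _ _).1 hdvd))

theorem stmt8 : IsGLDomain ↥ZplusXRX :=
  isGLDomain_of_exists_prime_dvd fun _ ↦ ZplusXRX.exists_prime_dvd
end
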